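/- arXiv:2203.04146 — 5 statements merged into one kernel-verified Lean document; each statement's English description precedes it below -/
import Mathlib

section
/- Proposition 1 (parallel model, 'if' direction): Let n ≥ 1 and let H be a hyperproperty that has losing counterexamples in the parallel model with n traces. If there exists a winning strategy for H in the parallel model with n traces, then there exists an enforcement mechanism that is sound and transparent for H in the parallel model with n traces. -/
/- Common setup: input propositions `Inp`, output propositions `Out`,
   Σ = Inp ⊕ Out (disjoint union).  An event is a subset of Σ. -/

namespace RE

abbrev Event (Inp Out : Type*) := Set (Inp ⊕ Out)
abbrev InfTrace (Inp Out : Type*) := ℕ → Event Inp Out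
abbrev FinTrace (Inp Out : Type*) := List (Event Inp Out)
abbrev Hyperproperty (Inp Out : Type*) := Set (Set (InfTrace Inp Out))

variable {Inp Out : Type*} {n k : ℕ}

/-- input part `e ∩ I` of an event -/
def inPart (e : Event Inp Out) : Set Inp := {a | Sum.inl a ∈ e}

/-- output part `e ∩ O` of an event -/
def outPart (e : Event Inp Out) : Set Out := {b | Sum.inr b ∈ e}

/-- the event `i ∪ o` built from an input part and an output part -/
def evt (i : Set Inp) (o : Set Out) : Event Inp Out :=
  Sum.inl '' i ∪ Sum.inr '' o

/-! ### Parallel trace input model with `n` traces.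
A prefix (an `n`-tuple of equally long finite traces) is represented
position-majorly as a list of columns `Fin n → Event`. -/

abbrev PPrefix (Inp Out : Type*) (n : ℕ) := List (Fin n → Event Inp Out)

/-- a continuation function `List ((Set I)^n) → (Set O)^n` -/
abbrev PCont (Inp Out : Type*) (n : ℕ) :=
  List (Fin n → Set Inp) → (Fin n → Set Out)

/-- a prefixed strategy in the parallel model -/
abbrev PStrategy (Inp Out : Type*) (n : ℕ) := PPrefix Inp Out n → PCont Inp Out n

/-- the `i`-th trace of the run induced by prefix `U`, continuation `f`
and input sequence `v`:
`uᵢ · (v(0)ᵢ ∪ f(ε)ᵢ) · (v(1)ᵢ ∪ f(v(0))ᵢ) · …` -/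
def prun (U : PPrefix Inp Out n) (f : PCont Inp Out n)
    (v : ℕ → Fin n → Set Inp) (i : Fin n) : InfTrace Inp Out := fun j =>
  if h : j < U.length then U.get ⟨j, h⟩ i
  else evt (v (j - U.length) i) (f ((List.range (j - U.length)).map v) i)

/-- the set of the `n` traces of the induced run -/
def prunSet (U : PPrefix Inp Out n) (f : PCont Inp Out n)
    (v : ℕ → Fin n → Set Inp) : Set (InfTrace Inp Out) :=
  Set.range (prun U f v)

/-- `σ(U) = f` is winning for `H` (i.e. not losing) -/
def PContWinning (H : Hyperproperty Inp Out) (U : PPrefix Inp Out n)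
    (f : PCont Inp Out n) : Prop :=
  ∀ v : ℕ → Fin n → Set Inp, prunSet U f v ∈ H

/-- `U` is a winning prefix for `H` -/
def PWinningPrefix (H : Hyperproperty Inp Out) (U : PPrefix Inp Out n) : Prop :=
  ∃ f : PCont Inp Out n, PContWinning H U f

/-- `σ` is a winning strategy for `H`: `σ(ε)` is winning and `σ(U)` is
winning for every winning prefix `U` -/
def PWinningStrategy (H : Hyperproperty Inp Out) (σ : PStrategy Inp Out n) : Prop :=
  PContWinning H [] (σ []) ∧
  ∀ U : PPrefix Inp Out n, PWinningPrefix H U → PContWinning H U (σ U)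

/-- a reactive system in the parallel model -/
abbrev PSystem (Inp Out : Type*) (n : ℕ) := PCont Inp Out n

/-- the prefix produced by system `S` on the finite input history `s` -/
def psysPrefix (S : PSystem Inp Out n) (s : List (Fin n → Set Inp)) :
    PPrefix Inp Out n :=
  List.ofFn (fun j : Fin s.length => fun i => evt (s.get j i) (S (s.take j) i))

/-- soundness of an enforcement mechanism in the parallel model -/
def PSound (H : Hyperproperty Inp Out)
    (enf : PSystem Inp Out n → PSystem Inp Out n) : Prop :=
  ∀ (S : PSystem Inp Out n) (v : ℕ → Fin n → Set Inp),
    prunSet [] (enf S) v ∈ H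

/-- `U` is output-safe for `H`: replacing the input part of the `j`-th
event by any input tuple (keeping the output parts, truncating after `j`)
yields a winning prefix -/
def POutputSafe (H : Hyperproperty Inp Out) (U : PPrefix Inp Out n) : Prop :=
  ∀ (j : ℕ) (h : j < U.length) (i : Fin n → Set Inp),
    PWinningPrefix H
      (U.take j ++ [fun r => evt (i r) (outPart (U.get ⟨j, h⟩ r))])

/-- transparency of an enforcement mechanism in the parallel model -/
def PTransparent (H : Hyperproperty Inp Out)
    (enf : PSystem Inp Out n → PSystem Inp Out n) : Prop :=
  ∀ (S : PSystem Inp Out n) (s s' : List (Fin n → Set Inp)), s <+: s' →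
    POutputSafe H (psysPrefix S s) →
    psysPrefix S s <+: psysPrefix (enf S) s'

/-- the tuple of length-`m` prefixes of an `n`-tuple of infinite traces -/
def ptracePrefix (t : Fin n → InfTrace Inp Out) (m : ℕ) : PPrefix Inp Out n :=
  List.ofFn (fun j : Fin m => fun i => t i (j : ℕ))

/-- `H` has losing counterexamples in the parallel model with `n` traces -/
def PLosingCounterexamples (H : Hyperproperty Inp Out) (n : ℕ) : Prop :=
  ∀ t : Fin n → InfTrace Inp Out,
    (∀ m : ℕ, PWinningPrefix H (ptracePrefix t m)) → Set.range t ∈ H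

/-! ### Sequential trace input model. -/

/-- a prefixed strategy in the sequential model -/
abbrev SeqStrategy (Inp Out : Type*) :=
  List (InfTrace Inp Out) → FinTrace Inp Out → List (Set Inp) → Set Out

/-- the session trace `u · (v(0) ∪ g(ε)) · (v(1) ∪ g(v(0))) · …` -/
def seqSession (g : List (Set Inp) → Set Out) (u : FinTrace Inp Out)
    (v : ℕ → Set Inp) : InfTrace Inp Out := fun j =>
  if h : j < u.length then u.get ⟨j, h⟩
  else evt (v (j - u.length)) (g ((List.range (j - u.length)).map v))

/-- the induced run `t₀, t₁, …` of strategy `σ` from prefix `(U,u)`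
on session inputs `V` -/
def seqRun (σ : SeqStrategy Inp Out) (U : List (InfTrace Inp Out))
    (u : FinTrace Inp Out) (V : ℕ → ℕ → Set Inp) : ℕ → InfTrace Inp Out
  | 0 => seqSession (σ U u) u (V 0)
  | (m + 1) =>
      seqSession
        (σ (U ++ List.ofFn (fun r : Fin (m + 1) => seqRun σ U u V r.val)) [])
        [] (V (m + 1))
  termination_by m => m
  decreasing_by exact r.isLt

/-- the trace set `{t | t ∈ U} ∪ {t₀, t₁, …}` of the induced run -/
def seqRunSet (σ : SeqStrategy Inp Out) (U : List (InfTrace Inp Out))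
    (u : FinTrace Inp Out) (V : ℕ → ℕ → Set Inp) : Set (InfTrace Inp Out) :=
  {t | t ∈ U} ∪ Set.range (seqRun σ U u V)

/-- `σ` is winning with `(U,u)` for `H` (i.e. not losing) -/
def SeqWinningWith (H : Hyperproperty Inp Out) (σ : SeqStrategy Inp Out)
    (U : List (InfTrace Inp Out)) (u : FinTrace Inp Out) : Prop :=
  ∀ V : ℕ → ℕ → Set Inp, seqRunSet σ U u V ∈ H

/-- `(U,u)` is a winning prefix for `H` -/
def SeqWinningPrefix (H : Hyperproperty Inp Out) (U : List (InfTrace Inp Out))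
    (u : FinTrace Inp Out) : Prop :=
  ∃ σ : SeqStrategy Inp Out, SeqWinningWith H σ U u

/-- `σ` is a winning strategy for `H`: winning with `([],ε)` and with
every winning prefix -/
def SeqWinningStrategy (H : Hyperproperty Inp Out) (σ : SeqStrategy Inp Out) : Prop :=
  SeqWinningWith H σ [] [] ∧
  ∀ (U : List (InfTrace Inp Out)) (u : FinTrace Inp Out),
    SeqWinningPrefix H U u → SeqWinningWith H σ U u

/-- a reactive system in the sequential model: it sees the input sequences
of the completed sessions and the input history of the current session -/
abbrev SeqSystem (Inp Out : Type*) :=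
  List (ℕ → Set Inp) → List (Set Inp) → Set Out

/-- the trace of one session of system `S` after completed session
inputs `prev`, on session input `v` -/
def seqSysSession (S : SeqSystem Inp Out) (prev : List (ℕ → Set Inp))
    (v : ℕ → Set Inp) : InfTrace Inp Out := fun j =>
  evt (v j) (S prev ((List.range j).map v))

/-- the `m`-th trace of the run of system `S` on session inputs `V` -/
def seqSysRun (S : SeqSystem Inp Out) (V : ℕ → ℕ → Set Inp) (m : ℕ) :
    InfTrace Inp Out :=
  seqSysSession S ((List.range m).map V) (V m)

/-- the sequential prefix produced by system `S` on completed session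
inputs `Vs` and current-session input history `s` -/
def seqSysPrefix (S : SeqSystem Inp Out) (Vs : List (ℕ → Set Inp))
    (s : List (Set Inp)) : List (InfTrace Inp Out) × FinTrace Inp Out :=
  (List.ofFn (fun m : Fin Vs.length => seqSysSession S (Vs.take m) (Vs.get m)),
   List.ofFn (fun j : Fin s.length => evt (s.get j) (S Vs (s.take j))))

/-- soundness of an enforcement mechanism in the sequential model -/
def SeqSound (H : Hyperproperty Inp Out)
    (enf : SeqSystem Inp Out → SeqSystem Inp Out) : Prop :=
  ∀ (S : SeqSystem Inp Out) (V : ℕ → ℕ → Set Inp),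
    Set.range (seqSysRun (enf S) V) ∈ H

/-- length-`j` prefix of an infinite trace as a finite trace -/
def finPrefOf (t : InfTrace Inp Out) (j : ℕ) : FinTrace Inp Out :=
  List.ofFn (fun r : Fin j => t r.val)

/-- `(U,u)` is output-safe for `H`: replacing the input part of any event
of the run by any input (keeping output parts, truncating right after that
event) yields a winning prefix -/
def SeqOutputSafe (H : Hyperproperty Inp Out) (U : List (InfTrace Inp Out))
    (u : FinTrace Inp Out) : Prop :=
  (∀ (m : ℕ) (h : m < U.length) (j : ℕ) (i : Set Inp),
    SeqWinningPrefix H (U.take m)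
      (finPrefOf (U.get ⟨m, h⟩) j ++ [evt i (outPart (U.get ⟨m, h⟩ j))])) ∧
  (∀ (j : ℕ) (h : j < u.length) (i : Set Inp),
    SeqWinningPrefix H U (u.take j ++ [evt i (outPart (u.get ⟨j, h⟩))]))

/-- the sequential prefix relation `(U,u) ⪯ (V,v)` -/
def SeqPrefixRel (p q : List (InfTrace Inp Out) × FinTrace Inp Out) : Prop :=
  (p.1 = q.1 ∧ p.2 <+: q.2) ∨
  (p.1.length < q.1.length ∧ q.1.take p.1.length = p.1 ∧
    ∀ (j : ℕ) (h : j < p.2.length),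
      p.2.get ⟨j, h⟩ = q.1.getD p.1.length (fun _ => (∅ : Event Inp Out)) j)

/-- the analogous prefix relation on session inputs -/
def SeqInputPrefixRel (p q : List (ℕ → Set Inp) × List (Set Inp)) : Prop :=
  (p.1 = q.1 ∧ p.2 <+: q.2) ∨
  (p.1.length < q.1.length ∧ q.1.take p.1.length = p.1 ∧
    ∀ (j : ℕ) (h : j < p.2.length),
      p.2.get ⟨j, h⟩ = q.1.getD p.1.length (fun _ => (∅ : Set Inp)) j)

/-- transparency of an enforcement mechanism in the sequential model -/
def SeqTransparent (H : Hyperproperty Inp Out)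
    (enf : SeqSystem Inp Out → SeqSystem Inp Out) : Prop :=
  ∀ (S : SeqSystem Inp Out) (Vs : List (ℕ → Set Inp)) (s : List (Set Inp))
    (Vs' : List (ℕ → Set Inp)) (s' : List (Set Inp)),
    SeqInputPrefixRel (Vs, s) (Vs', s') →
    SeqOutputSafe H (seqSysPrefix S Vs s).1 (seqSysPrefix S Vs s).2 →
    SeqPrefixRel (seqSysPrefix S Vs s) (seqSysPrefix (enf S) Vs' s')

/-- `H` has losing counterexamples in the sequential model -/
def SeqLosingCounterexamples (H : Hyperproperty Inp Out) : Prop :=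
  ∀ t : ℕ → InfTrace Inp Out,
    (∀ (m j : ℕ),
      SeqWinningPrefix H (List.ofFn (fun r : Fin m => t r.val)) (finPrefOf (t m) j)) →
    Set.range t ∈ H

/-! ### Quantifier-free HyperLTL with trace variables from `Fin k`. -/

inductive HForm (α : Type*) (k : ℕ) : Type _
  | tt : HForm α k
  | atom : α → Fin k → HForm α k
  | neg : HForm α k → HForm α k
  | disj : HForm α k → HForm α k → HForm α k
  | next : HForm α k → HForm α k
  | until_ : HForm α k → HForm α k → HForm α k

/-- semantics of quantifier-free HyperLTL w.r.t. a trace assignment -/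
def HSat {α : Type*} : HForm α k → (Fin k → (ℕ → Set α)) → ℕ → Prop
  | .tt, _, _ => True
  | .atom a p, A, j => a ∈ A p j
  | .neg φ, A, j => ¬ HSat φ A j
  | .disj φ ψ, A, j => HSat φ A j ∨ HSat ψ A j
  | .next φ, A, j => HSat φ A (j + 1)
  | .until_ φ ψ, A, j =>
      ∃ m, j ≤ m ∧ HSat ψ A m ∧ ∀ l, j ≤ l → l < m → HSat φ A l

/-- `T ⊨ ∀π₁…∀πₖ. φ` -/
def SatForall {α : Type*} (T : Set (ℕ → Set α)) (φ : HForm α k) : Prop :=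
  ∀ A : Fin k → (ℕ → Set α), (∀ p, A p ∈ T) → HSat φ A 0

namespace HForm

def conj {α : Type*} (φ ψ : HForm α k) : HForm α k := .neg (.disj (.neg φ) (.neg ψ))

def iff_ {α : Type*} (φ ψ : HForm α k) : HForm α k :=
  conj (.disj (.neg φ) ψ) (.disj (.neg ψ) φ)

def always {α : Type*} (φ : HForm α k) : HForm α k := .neg (.until_ .tt (.neg φ))

/-- weak until `φ W ψ := (φ U ψ) ∨ G φ` -/
def wuntil {α : Type*} (φ ψ : HForm α k) : HForm α k := .disj (.until_ φ ψ) (always φ)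

end HForm

def bigConj {α : Type*} (l : List (HForm α k)) : HForm α k := l.foldr HForm.conj .tt

def bigDisj {α : Type*} (l : List (HForm α k)) : HForm α k :=
  l.foldr HForm.disj (.neg .tt)

/-- the formula `ψ₂ = ∀π.∀π'. (⋀_{o∈O}(o_π ↔ o_{π'})) W (⋁_{i∈I} ¬(i_π ↔ i_{π'}))`
(its quantifier-free matrix with two trace variables) -/
noncomputable def psi2 (Inp Out : Type*) [Fintype Inp] [Fintype Out] : HForm (Inp ⊕ Out) 2 :=
  HForm.wuntil
    (bigConj ((Finset.univ : Finset Out).toList.map (fun o =>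
      HForm.iff_ (.atom (Sum.inr o) 0) (.atom (Sum.inr o) 1))))
    (bigDisj ((Finset.univ : Finset Inp).toList.map (fun i =>
      .neg (HForm.iff_ (.atom (Sum.inl i) 0) (.atom (Sum.inl i) 1)))))

/-- the play of a Moore strategy `f` on an input sequence `v` -/
def play (f : List (Set Inp) → Set Out) (v : ℕ → Set Inp) : InfTrace Inp Out :=
  fun m => evt (v m) (f ((List.range m).map v))

/-- `∀^k φ` is realizable: some Moore strategy's full set of plays satisfies it -/
def Realizable (φ : HForm (Inp ⊕ Out) k) : Prop :=
  ∃ f : List (Set Inp) → Set Out,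
    SatForall (Set.range (fun v : ℕ → Set Inp => play f v)) φ

/-! ### LTL over `Σ × Fin n` and the HyperLTL-to-LTL translation. -/

inductive LTL (β : Type*) : Type _
  | tt : LTL β
  | atom : β → LTL β
  | neg : LTL β → LTL β
  | disj : LTL β → LTL β → LTL β
  | next : LTL β → LTL β
  | until_ : LTL β → LTL β → LTL β

def LSat {β : Type*} : LTL β → (ℕ → Set β) → ℕ → Prop
  | .tt, _, _ => True
  | .atom b, w, j => b ∈ w j
  | .neg φ, w, j => ¬ LSat φ w j
  | .disj φ ψ, w, j => LSat φ w j ∨ LSat ψ w j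
  | .next φ, w, j => LSat φ w (j + 1)
  | .until_ φ ψ, w, j =>
      ∃ m, j ≤ m ∧ LSat ψ w m ∧ ∀ l, j ≤ l → l < m → LSat φ w l

def LTL.conj {β : Type*} (φ ψ : LTL β) : LTL β := .neg (.disj (.neg φ) (.neg ψ))

def lbigConj {β : Type*} (l : List (LTL β)) : LTL β := l.foldr LTL.conj .tt

/-- `φ[ρ]`: replace each atom `a_π` by `(a, ρ(π))` -/
def trLTL {α : Type*} : HForm α k → (Fin k → Fin n) → LTL (α × Fin n)
  | .tt, _ => .tt
  | .atom a p, ρ => .atom (a, ρ p)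
  | .neg φ, ρ => .neg (trLTL φ ρ)
  | .disj φ ψ, ρ => .disj (trLTL φ ρ) (trLTL ψ ρ)
  | .next φ, ρ => .next (trLTL φ ρ)
  | .until_ φ ψ, ρ => .until_ (trLTL φ ρ) (trLTL ψ ρ)

/-- `φ^n_LTL := ⋀_{ρ : Fin k → Fin n} φ[ρ]` -/
noncomputable def phiLTL {α : Type*} (n : ℕ) (φ : HForm α k) : LTL (α × Fin n) :=
  lbigConj ((Finset.univ : Finset (Fin k → Fin n)).toList.map (fun ρ => trLTL φ ρ))

/-- `zip(t₁,…,tₙ)`: `(a,i) ∈ zip(t)(m)` iff `a ∈ tᵢ(m)` -/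
def zipFam {α : Type*} (t : Fin n → (ℕ → Set α)) : ℕ → Set (α × Fin n) :=
  fun m => {p | p.1 ∈ t p.2 m}

/-- event over `Σ × Fin n` built from inputs in `I × Fin n` and
outputs in `O × Fin n` -/
def evtN (i : Set (Inp × Fin n)) (o : Set (Out × Fin n)) :
    Set ((Inp ⊕ Out) × Fin n) :=
  {p | (∃ a, p.1 = Sum.inl a ∧ (a, p.2) ∈ i) ∨ (∃ b, p.1 = Sum.inr b ∧ (b, p.2) ∈ o)}

end RE

namespace RE

variable {Inp Out : Type*} {n : ℕ}

lemma outPart_evt (i : Set Inp) (o : Set Out) : outPart (evt i o) = o := by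
  ext b
  simp [outPart, evt]

lemma length_psysPrefix (S : PSystem Inp Out n) (s : List (Fin n → Set Inp)) :
    (psysPrefix S s).length = s.length := by
  simp [psysPrefix]

lemma getElem_psysPrefix (S : PSystem Inp Out n) (s : List (Fin n → Set Inp)) (j : ℕ)
    (h : j < (psysPrefix S s).length) :
    (psysPrefix S s)[j] = fun i => evt
      ((s[j]'(by rwa [length_psysPrefix] at h)) i) (S (s.take j) i) := by
  simp [psysPrefix]

lemma psysPrefix_take (S : PSystem Inp Out n) (s : List (Fin n → Set Inp)) (j : ℕ) :
    psysPrefix S (s.take j) = (psysPrefix S s).take j := by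
  apply List.ext_getElem
  · simp [length_psysPrefix]
  · intro k h₁ h₂
    have hk : k < j := by
      simp only [length_psysPrefix, List.length_take] at h₁
      omega
    simp [getElem_psysPrefix, List.take_take, hk.le]

lemma psysPrefix_append_singleton (S : PSystem Inp Out n) (s : List (Fin n → Set Inp))
    (i : Fin n → Set Inp) :
    psysPrefix S (s ++ [i]) = psysPrefix S s ++ [fun r => evt (i r) (S s r)] := by
  apply List.ext_getElem
  · simp [length_psysPrefix]
  · intro k h₁ h₂
    have hk : k < s.length + 1 := by simpa [length_psysPrefix] using h₁
    rcases Nat.lt_succ_iff_lt_or_eq.mp hk with h | rfl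
    · rw [List.getElem_append_left (by rwa [length_psysPrefix])]
      simp [getElem_psysPrefix, List.getElem_append_left h, List.take_append_of_le_length h.le]
    · rw [List.getElem_append_right (by rw [length_psysPrefix])]
      simp [getElem_psysPrefix]

/-- The next output of `S` after the history `s` keeps the prefix winning, whatever the next
input is. -/
def PSafeStep (H : Hyperproperty Inp Out) (S : PSystem Inp Out n)
    (s : List (Fin n → Set Inp)) : Prop :=
  ∀ i : Fin n → Set Inp, PWinningPrefix H (psysPrefix S (s ++ [i]))

lemma POutputSafe.safeStep {H : Hyperproperty Inp Out} {S : PSystem Inp Out n}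
    {s : List (Fin n → Set Inp)} (h : POutputSafe H (psysPrefix S s)) {j : ℕ}
    (hj : j < s.length) : PSafeStep H S (s.take j) := by
  intro i
  have := h j (by rwa [length_psysPrefix]) i
  simpa [psysPrefix_append_singleton, psysPrefix_take, getElem_psysPrefix, outPart_evt] using this

open Classical in
/-- Follow `S` until its next output is no longer safe; from then on, follow `σ` with the prefix
produced by `S` so far. -/
noncomputable def guardedEnforcer (H : Hyperproperty Inp Out) (σ : PStrategy Inp Out n)
    (S : PSystem Inp Out n) : PSystem Inp Out n := fun s =>
  if h : ∃ j, j ≤ s.length ∧ ¬ PSafeStep H S (s.take j) then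
    σ (psysPrefix S (s.take (Nat.find h))) (s.drop (Nat.find h))
  else S s

lemma guardedEnforcer_of_safe {H : Hyperproperty Inp Out} (σ : PStrategy Inp Out n)
    {S : PSystem Inp Out n} {s : List (Fin n → Set Inp)}
    (h : ∀ j ≤ s.length, PSafeStep H S (s.take j)) : guardedEnforcer H σ S s = S s := by
  rw [guardedEnforcer, dif_neg]
  rintro ⟨j, hj, hn⟩
  exact hn (h j hj)

lemma guardedEnforcer_of_unsafe {H : Hyperproperty Inp Out} (σ : PStrategy Inp Out n)
    {S : PSystem Inp Out n} {s : List (Fin n → Set Inp)} {j : ℕ} (hj : j ≤ s.length)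
    (hu : ¬ PSafeStep H S (s.take j)) (hs : ∀ l < j, PSafeStep H S (s.take l)) :
    guardedEnforcer H σ S s = σ (psysPrefix S (s.take j)) (s.drop j) := by
  classical
  have h : ∃ j, j ≤ s.length ∧ ¬ PSafeStep H S (s.take j) := ⟨j, hj, hu⟩
  have hf : Nat.find h = j :=
    (Nat.find_eq_iff h).mpr ⟨⟨hj, hu⟩, fun l hl hl' => hl'.2 (hs l hl)⟩
  rw [guardedEnforcer, dif_pos h]
  convert rfl using 3 <;> rw [← hf]

lemma take_map_range {α : Type*} (v : ℕ → α) {j m : ℕ} (h : j ≤ m) :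
    ((List.range m).map v).take j = (List.range j).map v := by
  rw [← List.map_take, List.take_range, min_eq_left h]

lemma drop_map_range {α : Type*} (v : ℕ → α) (j m : ℕ) :
    ((List.range m).map v).drop j = (List.range (m - j)).map fun l => v (j + l) := by
  apply List.ext_getElem <;> simp

lemma prun_nil (S : PSystem Inp Out n) (v : ℕ → Fin n → Set Inp) (i : Fin n) (m : ℕ) :
    prun [] S v i m = evt (v m i) (S ((List.range m).map v) i) := by
  simp [prun]

lemma ptracePrefix_prun_nil (S : PSystem Inp Out n) (v : ℕ → Fin n → Set Inp) (m : ℕ) :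
    ptracePrefix (prun [] S v) m = psysPrefix S ((List.range m).map v) := by
  apply List.ext_getElem
  · simp [ptracePrefix, length_psysPrefix]
  · intro k h₁ h₂
    have hk : k < m := by simpa [ptracePrefix] using h₁
    rw [getElem_psysPrefix]
    simp [ptracePrefix, prun_nil, take_map_range v hk.le, -List.map_take]

lemma psysPrefix_winning_of_safe {H : Hyperproperty Inp Out} {S : PSystem Inp Out n}
    {v : ℕ → Fin n → Set Inp} (hε : PWinningPrefix H ([] : PPrefix Inp Out n)) {m : ℕ}
    (h : ∀ l < m, PSafeStep H S ((List.range l).map v)) :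
    PWinningPrefix H (psysPrefix S ((List.range m).map v)) := by
  cases m with
  | zero => simpa [psysPrefix] using hε
  | succ m =>
    rw [List.range_succ, List.map_append]
    exact h m m.lt_succ_self (v m)

lemma guardedEnforcer_sound {H : Hyperproperty Inp Out} {σ : PStrategy Inp Out n}
    (hce : PLosingCounterexamples H n) (hσ : PWinningStrategy H σ) :
    PSound H (guardedEnforcer H σ) := by
  classical
  intro S v
  have hε : PWinningPrefix H ([] : PPrefix Inp Out n) := ⟨σ [], hσ.1⟩
  by_cases hex : ∃ j, ¬ PSafeStep H S ((List.range j).map v)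
  · obtain ⟨J, hu, hs⟩ : ∃ J, ¬ PSafeStep H S ((List.range J).map v) ∧
        ∀ l < J, PSafeStep H S ((List.range l).map v) :=
      ⟨Nat.find hex, Nat.find_spec hex, fun l hl => not_not.mp (Nat.find_min hex hl)⟩
    have hrun : prun [] (guardedEnforcer H σ S) v =
        prun (psysPrefix S ((List.range J).map v)) (σ (psysPrefix S ((List.range J).map v)))
          (fun l => v (J + l)) := by
      funext i m
      rw [prun_nil]
      rcases lt_or_ge m J with hm | hm
      · rw [guardedEnforcer_of_safe]
        · simp [prun, length_psysPrefix, hm, getElem_psysPrefix, take_map_range v hm.le,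
            -List.map_take]
        · intro l hl
          have hl : l ≤ m := by simpa using hl
          rw [take_map_range v hl]
          exact hs l (hl.trans_lt hm)
      · rw [guardedEnforcer_of_unsafe σ (j := J) (by simpa using hm)
            (by rwa [take_map_range v hm])
            (fun l hl => by rw [take_map_range v (hl.le.trans hm)]; exact hs l hl),
          take_map_range v hm, drop_map_range]
        simp [prun, length_psysPrefix, hm.not_gt, Nat.add_sub_cancel' hm]
    rw [prunSet, hrun]
    exact hσ.2 _ (psysPrefix_winning_of_safe hε hs) _
  · push Not at hex
    have hrun : prun [] (guardedEnforcer H σ S) v = prun [] S v := by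
      funext i m
      rw [prun_nil, prun_nil, guardedEnforcer_of_safe]
      intro l hl
      rw [take_map_range v (by simpa using hl)]
      exact hex l
    rw [prunSet, hrun]
    refine hce _ fun m => ?_
    rw [ptracePrefix_prun_nil]
    exact psysPrefix_winning_of_safe hε fun l _ => hex l

lemma guardedEnforcer_transparent (H : Hyperproperty Inp Out) (σ : PStrategy Inp Out n) :
    PTransparent H (guardedEnforcer H σ) := by
  rintro S s _ ⟨w, rfl⟩ hsafe
  have heq : psysPrefix S s = psysPrefix (guardedEnforcer H σ S) s := by
    apply List.ext_getElem
    · simp [length_psysPrefix]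
    · intro k h₁ h₂
      have hk : k < s.length := by rwa [length_psysPrefix] at h₁
      rw [getElem_psysPrefix, getElem_psysPrefix, guardedEnforcer_of_safe]
      intro l hl
      have hl : l ≤ k := by
        rw [List.length_take] at hl
        omega
      rw [List.take_take, min_eq_left hl]
      exact hsafe.safeStep (hl.trans_lt hk)
  have htake := psysPrefix_take (guardedEnforcer H σ S) (s ++ w) s.length
  rw [List.take_left] at htake
  rw [heq, htake]
  exact List.take_prefix _ _

end RE

open RE in
/-- Proposition 1 (parallel model, 'if' direction). -/
theorem parallel_enforceable_of_winning_strategy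
    {Inp Out : Type*} {n : ℕ} (hn : 1 ≤ n) (H : Hyperproperty Inp Out)
    (hce : PLosingCounterexamples H n)
    (hws : ∃ σ : PStrategy Inp Out n, PWinningStrategy H σ) :
    ∃ enf : PSystem Inp Out n → PSystem Inp Out n,
      PSound H enf ∧ PTransparent H enf := by
  obtain ⟨σ, hσ⟩ := hws
  exact ⟨guardedEnforcer H σ, guardedEnforcer_sound hce hσ, guardedEnforcer_transparent H σ⟩
end

section
/- Proposition 1 (sequential model, 'only if' direction): Let H be a hyperproperty that has losing counterexamples in the sequential model. If there exists an enforcement mechanism that is sound and transparent for H in the sequential model, then there exists a winning strategy for H in the sequential model. -/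
namespace RE

theorem inPart_evt {Inp Out : Type*} (i : Set Inp) (o : Set Out) : inPart (evt i o) = i := by
  ext a
  simp [inPart, evt]

theorem seqSession_nil {Inp Out : Type*} (g : List (Set Inp) → Set Out) (v : ℕ → Set Inp) :
    seqSession g [] v = fun j => evt (v j) (g ((List.range j).map v)) := by
  funext j
  simp [seqSession]

/-- The first `n` traces of an infinite sequence of traces. -/
def firstTraces {Inp Out : Type*} (x : ℕ → InfTrace Inp Out) (n : ℕ) : List (InfTrace Inp Out) :=
  List.ofFn (fun r : Fin n => x r.val)

@[simp] theorem length_firstTraces {Inp Out : Type*} (x : ℕ → InfTrace Inp Out) (n : ℕ) :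
    (firstTraces x n).length = n := by
  simp [firstTraces]

theorem getElem_firstTraces {Inp Out : Type*} (x : ℕ → InfTrace Inp Out) (n m : ℕ)
    (h : m < (firstTraces x n).length) : (firstTraces x n)[m] = x m := by
  simp [firstTraces]

theorem take_firstTraces {Inp Out : Type*} (x : ℕ → InfTrace Inp Out) {k n : ℕ} (h : k ≤ n) :
    (firstTraces x n).take k = firstTraces x k := by
  apply List.ext_getElem
  · simp [h]
  · intro i h₁ h₂
    simp [getElem_firstTraces]

/-- The infinite sequence of traces starting with the list `U` and continuing with `t`. -/
def appendTraces {Inp Out : Type*} (U : List (InfTrace Inp Out)) (t : ℕ → InfTrace Inp Out) :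
    ℕ → InfTrace Inp Out := fun r =>
  if h : r < U.length then U[r] else t (r - U.length)

theorem firstTraces_appendTraces {Inp Out : Type*} (U : List (InfTrace Inp Out))
    (t : ℕ → InfTrace Inp Out) (m : ℕ) :
    firstTraces (appendTraces U t) (U.length + m) = U ++ firstTraces t m := by
  apply List.ext_getElem
  · simp
  · intro i h₁ h₂
    simp [getElem_firstTraces, appendTraces, List.getElem_append]

theorem range_appendTraces {Inp Out : Type*} (U : List (InfTrace Inp Out))
    (t : ℕ → InfTrace Inp Out) :
    Set.range (appendTraces U t) = {a | a ∈ U} ∪ Set.range t := by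
  ext a
  constructor
  · rintro ⟨r, rfl⟩
    by_cases h : r < U.length
    · left
      simp [appendTraces, h]
    · right
      exact ⟨r - U.length, by simp [appendTraces, h]⟩
  · rintro (h | ⟨r, rfl⟩)
    · obtain ⟨r, hr, rfl⟩ := List.getElem_of_mem h
      exact ⟨r, by simp [appendTraces, hr]⟩
    · exact ⟨U.length + r, by simp [appendTraces]⟩

theorem seqRun_zero {Inp Out : Type*} (σ : SeqStrategy Inp Out) (U : List (InfTrace Inp Out))
    (u : FinTrace Inp Out) (V : ℕ → ℕ → Set Inp) :
    seqRun σ U u V 0 = seqSession (σ U u) u (V 0) := by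
  rw [seqRun]

theorem seqRun_succ {Inp Out : Type*} (σ : SeqStrategy Inp Out) (U : List (InfTrace Inp Out))
    (u : FinTrace Inp Out) (V : ℕ → ℕ → Set Inp) (m : ℕ) :
    seqRun σ U u V (m + 1) =
      seqSession (σ (U ++ firstTraces (seqRun σ U u V) (m + 1)) []) [] (V (m + 1)) := by
  rw [seqRun]
  rfl

theorem seqRun_nil {Inp Out : Type*} (σ : SeqStrategy Inp Out) (U : List (InfTrace Inp Out))
    (V : ℕ → ℕ → Set Inp) (m : ℕ) :
    seqRun σ U [] V m = seqSession (σ (U ++ firstTraces (seqRun σ U [] V) m) []) [] (V m) := by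
  cases m with
  | zero => simp [seqRun_zero, firstTraces]
  | succ m => exact seqRun_succ σ U [] V m

theorem firstTraces_congr {Inp Out : Type*} {x y : ℕ → InfTrace Inp Out} {n : ℕ}
    (h : ∀ m < n, x m = y m) : firstTraces x n = firstTraces y n := by
  simp only [firstTraces]
  congr 1
  funext r
  exact h r r.isLt

theorem append_firstTraces_succ {Inp Out : Type*} (U : List (InfTrace Inp Out))
    (x : ℕ → InfTrace Inp Out) (m : ℕ) :
    U ++ firstTraces x (m + 1) = (U ++ [x 0]) ++ firstTraces (fun r => x (r + 1)) m := by
  simp [firstTraces, List.ofFn_succ]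

/-- After its first session, a run is a run from the next session boundary. -/
theorem seqRun_succ_eq {Inp Out : Type*} (σ : SeqStrategy Inp Out) (U : List (InfTrace Inp Out))
    (u : FinTrace Inp Out) (V : ℕ → ℕ → Set Inp) (m : ℕ) :
    seqRun σ U u V (m + 1) =
      seqRun σ (U ++ [seqSession (σ U u) u (V 0)]) [] (fun r => V (r + 1)) m := by
  induction m using Nat.strong_induction_on with
  | _ m ih =>
    rw [seqRun_succ, seqRun_nil, append_firstTraces_succ, firstTraces_congr ih, seqRun_zero]

theorem seqRunSet_eq {Inp Out : Type*} (σ : SeqStrategy Inp Out) (U : List (InfTrace Inp Out))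
    (u : FinTrace Inp Out) (V : ℕ → ℕ → Set Inp) :
    seqRunSet σ U u V =
      seqRunSet σ (U ++ [seqSession (σ U u) u (V 0)]) [] (fun r => V (r + 1)) := by
  have h : Set.range (seqRun σ U u V) = {seqSession (σ U u) u (V 0)} ∪
      Set.range (seqRun σ (U ++ [seqSession (σ U u) u (V 0)]) [] (fun r => V (r + 1))) := by
    ext a
    constructor
    · rintro ⟨m, rfl⟩
      cases m with
      | zero => exact Or.inl (seqRun_zero σ U u V)
      | succ m => exact Or.inr ⟨m, (seqRun_succ_eq σ U u V m).symm⟩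
    · rintro (rfl | ⟨m, rfl⟩)
      · exact ⟨0, seqRun_zero σ U u V⟩
      · exact ⟨m + 1, seqRun_succ_eq σ U u V m⟩
  rw [seqRunSet, seqRunSet, h]
  ext a
  simp [or_assoc, or_left_comm]

/-- If every session from `k` on follows `τ`, and `τ` is winning after the first `k` sessions, then
the set of all traces is in `H`. -/
theorem range_mem_of_follows {Inp Out : Type*} {H : Hyperproperty Inp Out}
    {τ : SeqStrategy Inp Out} {x : ℕ → InfTrace Inp Out} {k : ℕ}
    (hτ : SeqWinningWith H τ (firstTraces x k) [])
    (hx : ∀ m, k ≤ m → ∃ v, x m = seqSession (τ (firstTraces x m) []) [] v) :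
    Set.range x ∈ H := by
  choose v hv using fun m => hx (k + m) (Nat.le_add_right k m)
  have hsplit : appendTraces (firstTraces x k) (fun m => x (k + m)) = x := by
    funext r
    by_cases h : r < k
    · simp [appendTraces, h, getElem_firstTraces]
    · simp [appendTraces, h, Nat.add_sub_of_le (not_lt.mp h)]
  have hrun : ∀ m, seqRun τ (firstTraces x k) [] v m = x (k + m) := by
    intro m
    induction m using Nat.strong_induction_on with
    | _ m ih =>
      have h := firstTraces_appendTraces (firstTraces x k) (fun m => x (k + m)) m
      rw [hsplit, length_firstTraces] at h
      rw [seqRun_nil, firstTraces_congr ih, ← h, ← hv]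
  have h := hτ v
  rwa [seqRunSet, funext hrun, ← range_appendTraces, hsplit] at h

/-- `(U.take k, ε)` is winning and the sessions of `U` from `k` on follow the strategy `τ`
assigns to it. -/
def FollowsFrom {Inp Out : Type*} (H : Hyperproperty Inp Out)
    (τ : List (InfTrace Inp Out) → FinTrace Inp Out → SeqStrategy Inp Out)
    (U : List (InfTrace Inp Out)) (k : ℕ) : Prop :=
  k ≤ U.length ∧ SeqWinningPrefix H (U.take k) [] ∧
    ∀ (m : ℕ) (h : m < U.length), k ≤ m →
      ∃ v, U[m] = seqSession (τ (U.take k) [] (U.take m) []) [] v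

theorem followsFrom_firstTraces {Inp Out : Type*} {H : Hyperproperty Inp Out}
    {τ : List (InfTrace Inp Out) → FinTrace Inp Out → SeqStrategy Inp Out}
    {x : ℕ → InfTrace Inp Out} {n k : ℕ} :
    FollowsFrom H τ (firstTraces x n) k ↔ k ≤ n ∧ SeqWinningPrefix H (firstTraces x k) [] ∧
      ∀ m < n, k ≤ m →
        ∃ v, x m = seqSession (τ (firstTraces x k) [] (firstTraces x m) []) [] v := by
  refine and_congr (by rw [length_firstTraces]) Iff.rfl |>.trans (and_congr_right fun hk => ?_)
  rw [take_firstTraces x hk]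
  refine and_congr_right fun _ => forall_congr' fun m => ?_
  refine (forall_congr' fun hm => ?_).trans (imp_congr_left (by rw [length_firstTraces]))
  rw [getElem_firstTraces, take_firstTraces x (hm.trans_eq (length_firstTraces x n)).le]

open Classical in
/-- At a session boundary, keep to the earliest winning commitment that the history respects;
inside a session, play the strategy assigned to the current prefix. -/
noncomputable def commitStrategy {Inp Out : Type*} (H : Hyperproperty Inp Out)
    (τ : List (InfTrace Inp Out) → FinTrace Inp Out → SeqStrategy Inp Out) :
    SeqStrategy Inp Out := fun U u =>
  if u = [] then τ (U.take (sInf {k | FollowsFrom H τ U k})) [] U [] else τ U u U u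

theorem commitStrategy_winningWith_nil {Inp Out : Type*} {H : Hyperproperty Inp Out}
    {τ : List (InfTrace Inp Out) → FinTrace Inp Out → SeqStrategy Inp Out}
    (hτ : ∀ U u, SeqWinningPrefix H U u → SeqWinningWith H (τ U u) U u)
    {U : List (InfTrace Inp Out)} (hU : SeqWinningPrefix H U []) :
    SeqWinningWith H (commitStrategy H τ) U [] := by
  intro V
  set t := seqRun (commitStrategy H τ) U [] V with ht
  set x := appendTraces U t with hx
  have hxU : firstTraces x U.length = U := by
    simpa [firstTraces] using firstTraces_appendTraces U t 0
  set k := sInf {k | FollowsFrom H τ U k} with hk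
  have hkU : FollowsFrom H τ (firstTraces x U.length) k := by
    rw [hxU]
    refine Nat.sInf_mem (s := {k | FollowsFrom H τ U k}) ⟨U.length, le_rfl, by simpa using hU, ?_⟩
    intro m h h'
    omega
  have hstep : ∀ n, FollowsFrom H τ (firstTraces x (U.length + n)) k →
      ∃ v, x (U.length + n) = seqSession
        (τ (firstTraces x k) [] (firstTraces x (U.length + n)) []) [] v := by
    intro n hn
    have hmin : sInf {j | FollowsFrom H τ (firstTraces x (U.length + n)) j} = k := by
      refine le_antisymm (Nat.sInf_le hn) (le_csInf ⟨k, hn⟩ fun j hj => ?_)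
      by_contra! hjk
      refine absurd (Nat.sInf_le (s := {k | FollowsFrom H τ U k}) (m := j) ?_) (not_le.mpr hjk)
      have hj' := followsFrom_firstTraces.mp hj
      have hkle := (followsFrom_firstTraces.mp hkU).1
      have := followsFrom_firstTraces.mpr ⟨(hjk.trans_le hkle).le, hj'.2.1,
        fun m hm hjm => hj'.2.2 m (by omega) hjm⟩
      rwa [hxU] at this
    refine ⟨V n, ?_⟩
    have hxn : x (U.length + n) = t n := by simp [hx, appendTraces]
    rw [hxn, ht, seqRun_nil, ← ht, ← firstTraces_appendTraces, ← hx, commitStrategy, if_pos rfl,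
      hmin, take_firstTraces x (followsFrom_firstTraces.mp hn).1]
  have hfol : ∀ n, FollowsFrom H τ (firstTraces x (U.length + n)) k := by
    intro n
    induction n with
    | zero => exact hkU
    | succ n ih =>
      obtain ⟨h₁, h₂, h₃⟩ := followsFrom_firstTraces.mp ih
      refine followsFrom_firstTraces.mpr ⟨by omega, h₂, fun m hm hkm => ?_⟩
      rcases Nat.lt_or_ge m (U.length + n) with h | h
      · exact h₃ m h hkm
      · obtain rfl : m = U.length + n := by omega
        exact hstep n ih
  have hrange : seqRunSet (commitStrategy H τ) U [] V = Set.range x := by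
    rw [hx, range_appendTraces]
    rfl
  rw [hrange]
  refine range_mem_of_follows (k := k)
    (hτ _ _ (followsFrom_firstTraces.mp hkU).2.1) fun m hm => ?_
  exact (followsFrom_firstTraces.mp (hfol (m + 1))).2.2 m (by omega) hm

theorem commitStrategy_winningWith {Inp Out : Type*} {H : Hyperproperty Inp Out}
    {τ : List (InfTrace Inp Out) → FinTrace Inp Out → SeqStrategy Inp Out}
    (hτ : ∀ U u, SeqWinningPrefix H U u → SeqWinningWith H (τ U u) U u)
    {U : List (InfTrace Inp Out)} {u : FinTrace Inp Out} (hU : SeqWinningPrefix H U u) :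
    SeqWinningWith H (commitStrategy H τ) U u := by
  by_cases hu : u = []
  · subst hu
    exact commitStrategy_winningWith_nil hτ hU
  · intro V
    have hplay : commitStrategy H τ U u = τ U u U u := if_neg hu
    rw [seqRunSet_eq, hplay]
    refine commitStrategy_winningWith_nil hτ ⟨τ U u, fun V' => ?_⟩ _
    simpa [seqRunSet_eq _ U u] using hτ U u hU (fun m => Nat.casesOn m (V 0) V')

/-- A hyperproperty has a winning strategy as soon as the empty prefix is winning. -/
theorem exists_seqWinningStrategy {Inp Out : Type*} {H : Hyperproperty Inp Out}
    (h : SeqWinningPrefix H [] []) : ∃ σ : SeqStrategy Inp Out, SeqWinningStrategy H σ := by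
  have hτ : ∀ (U : List (InfTrace Inp Out)) (u : FinTrace Inp Out), ∃ τ : SeqStrategy Inp Out,
      SeqWinningPrefix H U u → SeqWinningWith H τ U u := by
    intro U u
    by_cases hU : SeqWinningPrefix H U u
    · exact hU.imp fun τ hτ _ => hτ
    · exact ⟨fun _ _ _ => ∅, fun h => absurd h hU⟩
  choose τ hτ using hτ
  exact ⟨commitStrategy H τ, commitStrategy_winningWith hτ h,
    fun _ _ hU => commitStrategy_winningWith hτ hU⟩

/-- A system viewed as a strategy that reads the inputs off the completed sessions. -/
def systemStrategy {Inp Out : Type*} (S : SeqSystem Inp Out) : SeqStrategy Inp Out :=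
  fun U _ => S (U.map fun t j => inPart (t j))

theorem seqRun_systemStrategy {Inp Out : Type*} (S : SeqSystem Inp Out) (V : ℕ → ℕ → Set Inp)
    (m : ℕ) : seqRun (systemStrategy S) [] [] V m = seqSysRun S V m := by
  induction m using Nat.strong_induction_on with
  | _ m ih =>
    have hin : (firstTraces (seqSysRun S V) m).map (fun t j => inPart (t j)) =
        (List.range m).map V := by
      apply List.ext_getElem
      · simp
      · intro i h₁ h₂
        simp [getElem_firstTraces, seqSysRun, seqSysSession, inPart_evt]
    rw [seqRun_nil, seqSession_nil, firstTraces_congr ih, List.nil_append, systemStrategy, hin]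
    rfl

theorem seqWinningPrefix_nil_of_sound {Inp Out : Type*} {H : Hyperproperty Inp Out}
    {enf : SeqSystem Inp Out → SeqSystem Inp Out} (h : SeqSound H enf) :
    SeqWinningPrefix H [] [] := by
  refine ⟨systemStrategy (enf fun _ _ => ∅), fun V => ?_⟩
  rw [seqRunSet, funext (seqRun_systemStrategy _ V)]
  simpa using h (fun _ _ => ∅) V

end RE

open RE in
/-- Proposition 1 (sequential model, 'only if' direction). -/
theorem sequential_winning_strategy_of_enforceable
    {Inp Out : Type*} (H : Hyperproperty Inp Out)
    (hce : SeqLosingCounterexamples H)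
    (henf : ∃ enf : SeqSystem Inp Out → SeqSystem Inp Out,
      SeqSound H enf ∧ SeqTransparent H enf) :
    ∃ σ : SeqStrategy Inp Out, SeqWinningStrategy H σ := by
  obtain ⟨enf, hsound, -⟩ := henf
  exact exists_seqWinningStrategy (seqWinningPrefix_nil_of_sound hsound)
end

section
/- Characterization of the symmetry formula ψ₂: For every set T of infinite traces over Σ = I ∪ O, T ⊨ ψ₂ if and only if for all traces t, t' ∈ T and all k ∈ ℕ: if t(j) ∩ I = t'(j) ∩ I for all j ≤ k, then t(k) ∩ O = t'(k) ∩ O. -/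
namespace RE

section Semantics

variable {α : Type*} {k : ℕ} {A : Fin k → ℕ → Set α} {j : ℕ}

theorem hSat_conj {φ ψ : HForm α k} :
    HSat (HForm.conj φ ψ) A j ↔ HSat φ A j ∧ HSat ψ A j := by
  simp [HForm.conj, HSat]

theorem hSat_iff {φ ψ : HForm α k} :
    HSat (HForm.iff_ φ ψ) A j ↔ (HSat φ A j ↔ HSat ψ A j) := by
  simp only [HForm.iff_, hSat_conj, HSat]
  tauto

theorem hSat_always {φ : HForm α k} :
    HSat (HForm.always φ) A j ↔ ∀ m, j ≤ m → HSat φ A m := by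
  simp [HForm.always, HSat]

theorem hSat_wuntil {φ ψ : HForm α k} :
    HSat (HForm.wuntil φ ψ) A j ↔
      ∀ m, j ≤ m → (∀ l, j ≤ l → l ≤ m → ¬ HSat ψ A l) → HSat φ A m := by
  classical
  simp only [HForm.wuntil, HSat, hSat_always]
  constructor
  · rintro (⟨m, hjm, hψ, hφ⟩ | h) n hjn hn
    · exact hφ n hjn (not_le.mp fun hmn => hn m hjm hmn hψ)
    · exact h n hjn
  · intro h
    by_cases hex : ∃ m, j ≤ m ∧ HSat ψ A m
    · obtain ⟨hjm, hψ⟩ := Nat.find_spec hex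
      exact Or.inl ⟨Nat.find hex, hjm, hψ, fun l hjl hl => h l hjl fun i hji hil hi =>
        Nat.find_min hex (hil.trans_lt hl) ⟨hji, hi⟩⟩
    · exact Or.inr fun m hjm => h m hjm fun l hjl _ hl => hex ⟨l, hjl, hl⟩

theorem hSat_bigConj {L : List (HForm α k)} :
    HSat (bigConj L) A j ↔ ∀ φ ∈ L, HSat φ A j := by
  induction L with
  | nil => simp [bigConj, HSat]
  | cons φ L ih =>
    rw [List.forall_mem_cons, ← ih]
    exact hSat_conj

theorem hSat_bigDisj {L : List (HForm α k)} :
    HSat (bigDisj L) A j ↔ ∃ φ ∈ L, HSat φ A j := by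
  induction L with
  | nil => simp [bigDisj, HSat]
  | cons φ L ih =>
    rw [List.exists_mem_cons_iff, ← ih]
    rfl

end Semantics

theorem hSat_psi2 {Inp Out : Type*} [Fintype Inp] [Fintype Out]
    {A : Fin 2 → InfTrace Inp Out} :
    HSat (psi2 Inp Out) A 0 ↔
      ∀ m, (∀ j ≤ m, inPart (A 0 j) = inPart (A 1 j)) →
        outPart (A 0 m) = outPart (A 1 m) := by
  simp [psi2, hSat_wuntil, hSat_bigConj, hSat_bigDisj, hSat_iff, HSat, Set.ext_iff,
    inPart, outPart]

end RE

open RE in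
/-- Characterization of the symmetry formula ψ₂. -/
theorem psi2_characterization
    {Inp Out : Type*} [Fintype Inp] [Fintype Out]
    (T : Set (InfTrace Inp Out)) :
    SatForall T (psi2 Inp Out) ↔
      ∀ t ∈ T, ∀ t' ∈ T, ∀ k : ℕ,
        (∀ j ≤ k, inPart (t j) = inPart (t' j)) →
        outPart (t k) = outPart (t' k) := by
  constructor
  · intro h t ht t' ht'
    exact hSat_psi2.mp (h ![t, t'] (by simp [Fin.forall_fin_two, ht, ht']))
  · intro h A hA
    exact hSat_psi2.mpr (h (A 0) (hA 0) (A 1) (hA 1))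
end

section
/- Correctness of the HyperLTL-to-LTL translation for the parallel model: For every n ≥ 1, every quantifier-free HyperLTL formula φ over Σ with trace variables from Fin k, and all infinite traces t₁,…,tₙ over Σ: the set {t₁,…,tₙ} satisfies ∀^k φ if and only if the zipped infinite trace zip(t₁,…,tₙ) over Σ × Fin n satisfies the LTL formula φ^n_LTL. -/
namespace RE

theorem LSat_conj {β : Type*} (φ ψ : LTL β) (w : ℕ → Set β) (j : ℕ) :
    LSat (φ.conj ψ) w j ↔ LSat φ w j ∧ LSat ψ w j := by
  simp only [LTL.conj, LSat]
  tauto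

theorem LSat_lbigConj {β : Type*} (l : List (LTL β)) (w : ℕ → Set β) (j : ℕ) :
    LSat (lbigConj l) w j ↔ ∀ φ ∈ l, LSat φ w j := by
  induction l with
  | nil => simp [lbigConj, LSat]
  | cons φ l ih =>
    rw [List.forall_mem_cons, ← ih]
    exact LSat_conj φ (lbigConj l) w j

theorem LSat_trLTL {α : Type*} {k n : ℕ} (φ : HForm α k) (ρ : Fin k → Fin n)
    (t : Fin n → ℕ → Set α) (j : ℕ) :
    LSat (trLTL φ ρ) (zipFam t) j ↔ HSat φ (fun p => t (ρ p)) j := by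
  induction φ generalizing j with
  | tt => rfl
  | atom a p => rfl
  | neg φ ih => simp only [trLTL, LSat, HSat, ih]
  | disj φ ψ ihφ ihψ => simp only [trLTL, LSat, HSat, ihφ, ihψ]
  | next φ ih => simp only [trLTL, LSat, HSat, ih]
  | until_ φ ψ ihφ ihψ => simp only [trLTL, LSat, HSat, ihφ, ihψ]

theorem LSat_phiLTL {α : Type*} {k n : ℕ} (φ : HForm α k)
    (t : Fin n → ℕ → Set α) (j : ℕ) :
    LSat (phiLTL n φ) (zipFam t) j ↔
      ∀ ρ : Fin k → Fin n, HSat φ (fun p => t (ρ p)) j := by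
  simp [phiLTL, LSat_lbigConj, LSat_trLTL]

theorem satForall_range {α ι : Type*} {k : ℕ} (t : ι → ℕ → Set α) (φ : HForm α k) :
    SatForall (Set.range t) φ ↔ ∀ ρ : Fin k → ι, HSat φ (fun p => t (ρ p)) 0 := by
  refine ⟨fun h ρ => h _ fun p => ⟨ρ p, rfl⟩, fun h A hA => ?_⟩
  choose ρ hρ using hA
  obtain rfl : (fun p => t (ρ p)) = A := funext hρ
  exact h ρ

end RE

open RE in
/-- Correctness of the HyperLTL-to-LTL translation for the parallel model. -/
theorem hyperltl_to_ltl_correct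
    {Inp Out : Type*} {k n : ℕ} (hn : 1 ≤ n) (φ : HForm (Inp ⊕ Out) k)
    (t : Fin n → InfTrace Inp Out) :
    SatForall (Set.range t) φ ↔ LSat (phiLTL n φ) (zipFam t) 0 := by
  rw [satForall_range, LSat_phiLTL]
end

section
/- The existential hyperproperty ∃π. G a_π has no losing prefixes in the sequential model: Fix a ∈ O and let H_a := {T | ∃ t ∈ T, ∀ k ∈ ℕ, a ∈ t(k)} (the set of trace sets containing a trace on which a holds globally). Then in the sequential model every prefix (U,u) is winning for H_a; in particular no prefix is losing for H_a. -/
open RE in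
/-- The existential hyperproperty `∃π. G a_π` has no losing prefixes in the
sequential model: every prefix `(U,u)` is winning for it. -/
theorem exists_globally_no_losing_prefixes
    {Inp Out : Type*} (a : Out)
    (U : List (InfTrace Inp Out)) (u : FinTrace Inp Out) :
    SeqWinningPrefix
      {T : Set (InfTrace Inp Out) | ∃ t ∈ T, ∀ k : ℕ, Sum.inr a ∈ t k} U u := by
  refine ⟨fun _ _ _ => {a}, fun V => ⟨_, Or.inr ⟨1, rfl⟩, fun k => ?_⟩⟩
  simp [seqRun, seqSession, evt]
end
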